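/- There is no set Σ of identities, each of which involves at most 3 distinct variables, such that for every identity u ≈ v: the hypoplactic monoid hypo satisfies u ≈ v if and only if every monoid satisfying all identities in Σ satisfies u ≈ v. Consequently (since the basis {(L) xyzxty ≈ yxzxty, (M) xzxytx ≈ xzyxtx, (R) xzytxy ≈ xzytyx} consists of identities in 4 variables), the axiomatic rank of the variety generated by hypo is 4. -/

import Mathlib

open FreeMonoid

/-- The alphabet `A = {1 < 2 < 3 < ...}` of positive integers. -/
abbrev Alph : Type := ℕ+

/-- The finite alphabet `A_n = {1 < ... < n}`. -/
abbrev AlphN (n : ℕ) : Type := {a : ℕ+ // (a : ℕ) ≤ n}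

/-- The defining relations of the hypoplactic monoid. -/
def HypoRel (u v : FreeMonoid Alph) : Prop :=
  (∃ a b c : Alph, a ≤ b ∧ b < c ∧
      u = of a * of c * of b ∧ v = of c * of a * of b) ∨
  (∃ a b c : Alph, a < b ∧ b ≤ c ∧
      u = of b * of a * of c ∧ v = of b * of c * of a) ∨
  (∃ a b c d : Alph, a ≤ b ∧ b < c ∧ c ≤ d ∧
      u = of c * of a * of d * of b ∧ v = of a * of c * of b * of d) ∨
  (∃ a b c d : Alph, a < b ∧ b ≤ c ∧ c < d ∧
      u = of b * of d * of a * of c ∧ v = of d * of b * of c * of a)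

/-- The hypoplactic congruence on `A*`: the congruence generated by `HypoRel`. -/
def hypoCon : Con (FreeMonoid Alph) := conGen HypoRel

/-- The infinite-rank hypoplactic monoid `hypo`. -/
abbrev Hypo : Type := hypoCon.Quotient

/-- The inclusion of `A_n*` into `A*`. -/
def inclN (n : ℕ) : FreeMonoid (AlphN n) →* FreeMonoid Alph :=
  FreeMonoid.map Subtype.val

/-- The hypoplactic congruence restricted to `A_n*`. -/
def hypoConN (n : ℕ) : Con (FreeMonoid (AlphN n)) :=
  hypoCon.comap (inclN n) (fun x y => map_mul (inclN n) x y)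

/-- The rank-`n` hypoplactic monoid `hypo_n`. -/
abbrev HypoN (n : ℕ) : Type := (hypoConN n).Quotient

/-- The letter `1` of `A_2`. -/
def a1 : AlphN 2 := ⟨1, by norm_num⟩

/-- The letter `2` of `A_2`. -/
def a2 : AlphN 2 := ⟨2, by norm_num⟩

/-- The homomorphism `φ_{ij} : A* → hypo_2`, sending `i ↦ [1]`, `j ↦ [2]`,
`a ↦ [21]` for `i < a < j`, and every other letter to the identity. -/
def phi (i j : Alph) : FreeMonoid Alph →* HypoN 2 :=
  FreeMonoid.lift fun a =>
    if a = i then (hypoConN 2).mk' (of a1)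
    else if a = j then (hypoConN 2).mk' (of a2)
    else if i < a ∧ a < j then (hypoConN 2).mk' (of a2 * of a1)
    else 1

/-- A monoid `M` satisfies the identity `u ≈ v` (over the alphabet of variables `X`)
if every homomorphic evaluation of the two words in `M` gives equal values. -/
def MSatisfies (M : Type*) [Monoid M] {X : Type*} (u v : FreeMonoid X) : Prop :=
  ∀ ψ : FreeMonoid X →* M, ψ u = ψ v

/-- An identity `u ≈ v` is balanced if every variable occurs the same number of
times in `u` as in `v`. -/
def IsBalanced {X : Type*} [DecidableEq X] (u v : FreeMonoid X) : Prop :=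
  ∀ x : X, u.toList.count x = v.toList.count x

section Swaps

open scoped List

variable {X : Type*}

/-- Exchanging the adjacent letters `x`, `y` between `p` and `s` changes neither
whether `x` occurs before `y` nor whether `y` occurs before `x`. -/
def SwapOk (p s : List X) (x y : X) : Prop :=
  (y ∈ p ∨ x ∈ s) ∧ (x ∈ p ∨ y ∈ s)

/-- `f` takes the same value on words that differ by an admissible exchange of letters. -/
def SwapInvariant {γ : Sort*} (f : List X → γ) : Prop :=
  ∀ (p s : List X) (x y : X), SwapOk p s x y → f (p ++ x :: y :: s) = f (p ++ y :: x :: s)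

theorem SwapOk.mono {p s p' s' : List X} {x y : X} (h : SwapOk p s x y)
    (hp : p ⊆ p') (hs : s ⊆ s') : SwapOk p' s' x y :=
  ⟨h.1.imp (@hp _) (@hs _), h.2.imp (@hp _) (@hs _)⟩

theorem SwapInvariant.move_letter {γ : Sort*} {f : List X → γ} (hf : SwapInvariant f)
    (p s u : List X) (y : X) (h : ∀ x ∈ u, SwapOk p s x y) :
    f (p ++ (u ++ y :: s)) = f (p ++ y :: (u ++ s)) := by
  induction u generalizing p with
  | nil => rfl
  | cons x u ih =>
    have h₁ := ih (p ++ [x]) fun z hz =>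
      (h z (by simp [hz])).mono (by simp) (by simp)
    have h₂ := hf p (u ++ s) x y ((h x (by simp)).mono (by simp) (by simp))
    simp only [List.append_assoc, List.cons_append, List.nil_append] at h₁ ⊢
    exact h₁.trans h₂

theorem SwapInvariant.move_word {γ : Sort*} {f : List X → γ} (hf : SwapInvariant f)
    (p s u v : List X) (h : ∀ x ∈ u, ∀ y ∈ v, SwapOk p s x y) :
    f (p ++ (u ++ (v ++ s))) = f (p ++ (v ++ (u ++ s))) := by
  induction v generalizing p with
  | nil => rfl
  | cons y v ih =>
    have h₁ := hf.move_letter p (v ++ s) u y fun x hx =>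
      (h x hx y (by simp)).mono (by simp) (by simp)
    have h₂ := ih (p ++ [y]) fun x hx z hz =>
      (h x hx z (by simp [hz])).mono (by simp) (by simp)
    simp only [List.append_assoc, List.cons_append, List.nil_append] at h₂ ⊢
    exact h₁.trans h₂

theorem pair_sublist_cons {i j x : X} {l : List X} :
    [i, j] <+ x :: l ↔ (i = x ∧ j ∈ l) ∨ [i, j] <+ l := by
  rw [List.cons_sublist_cons']
  simp [or_comm]

theorem pair_sublist_append {i j : X} {u v : List X} :
    [i, j] <+ u ++ v ↔ [i, j] <+ u ∨ (i ∈ u ∧ j ∈ v) ∨ [i, j] <+ v := by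
  induction u with
  | nil => simp
  | cons x u ih =>
    rw [List.cons_append, pair_sublist_cons, ih, pair_sublist_cons]
    grind

theorem swapInvariant_pair_sublist (i j : X) :
    SwapInvariant fun l : List X => [i, j] <+ l := by
  rintro p s x y ⟨h₁, h₂⟩
  simp only [pair_sublist_append, pair_sublist_cons, List.mem_cons, eq_iff_iff]
  grind

/-- The combinatorial description of the identities `u ≈ v` of the hypoplactic monoid. -/
structure PairEquiv (u v : List X) : Prop where
  perm : u.Perm v
  pair : ∀ x y, x ≠ y → ([x, y] <+ u ↔ [x, y] <+ v)

theorem SwapInvariant.eq_of_pairEquiv {γ : Sort*} {f : List X → γ} (hf : SwapInvariant f)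
    {u v : List X} (h : PairEquiv u v) : f u = f v := by
  suffices H : ∀ u v p : List X, PairEquiv (p ++ u) (p ++ v) → f (p ++ u) = f (p ++ v) from
    H u v [] h
  clear h u v
  intro u
  induction u with
  | nil =>
    intro v p h
    have hv := (List.perm_append_left_iff p).1 h.perm
    rw [List.nil_perm.1 hv]
  | cons x u ih =>
    intro v p h
    have hv := (List.perm_append_left_iff p).1 h.perm
    obtain ⟨v₁, v₂, rfl, hx⟩ := List.eq_append_cons_of_mem (hv.subset (List.mem_cons_self))
    have huv : u.Perm (v₁ ++ v₂) := (hv.trans List.perm_middle).cons_inv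
    have hok : ∀ z ∈ v₁, SwapOk p v₂ z x := by
      intro z hz
      have hzx : z ≠ x := fun e => hx (e ▸ hz)
      have hzu : z ∈ u := huv.symm.subset (by simp [hz])
      have h₁ := h.pair x z hzx.symm
      have h₂ := h.pair z x hzx
      have hsub : ∀ {i j : X} {l : List X}, [i, j] <+ l → i ∈ l ∧ j ∈ l := fun H =>
        ⟨H.subset (by simp), H.subset (by simp)⟩
      have hxu : x ∈ u → x ∈ v₂ := fun hxu => by
        simpa [hx] using huv.subset hxu
      simp only [pair_sublist_append, pair_sublist_cons] at h₁ h₂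
      refine ⟨?_, ?_⟩
      · rcases h₁.1 (by simp [hzu]) with H | H | H | H | H | H
        · exact Or.inl (hsub H).1
        · exact Or.inl H.1
        · exact absurd (hsub H).1 hx
        · exact absurd H.1 hx
        · exact Or.inr H.2
        · exact Or.inr (hsub H).2
      · rcases h₂.2 (by simp [hz]) with H | H | H | H
        · exact Or.inl (hsub H).1
        · exact Or.inl H.1
        · exact absurd H.1 hzx
        · exact Or.inr (hxu (hsub H).2)
    rw [hf.move_letter p v₂ v₁ x hok]
    have key := ih (v₁ ++ v₂) (p ++ [x]) ⟨huv.append_left _, fun i j hij => by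
      have := (swapInvariant_pair_sublist i j).move_letter p v₂ v₁ x hok
      simp only [eq_iff_iff] at this
      simpa using (h.pair i j hij).trans this⟩
    simpa using key

end Swaps

section HypoLike

variable {α : Type*} [LinearOrder α]

/-- A congruence on words over an ordered alphabet containing the hypoplactic relations. -/
structure HypoLike (R : List α → List α → Prop) : Prop where
  symm : ∀ {u v}, R u v → R v u
  trans : ∀ {u v w}, R u v → R v w → R u w
  context : ∀ {u v} (p s : List α), R u v → R (p ++ (u ++ s)) (p ++ (v ++ s))
  swap_left : ∀ {a b c}, a ≤ b → b < c → R [a, c, b] [c, a, b]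
  swap_right : ∀ {a b c}, a < b → b ≤ c → R [b, a, c] [b, c, a]
  swap_both : ∀ {a b c d}, a ≤ b → b < c → c ≤ d → R [c, a, d, b] [a, c, b, d]
  swap_both' : ∀ {a b c d}, a < b → b ≤ c → c < d → R [b, d, a, c] [d, b, c, a]

/-- Letters `a < c` commute if fewer than `k` letters later comes some `b ∈ [a, c)`. -/
def CommBefore (R : List α → List α → Prop) (k : ℕ) : Prop :=
  ∀ (a b c : α) (E p s : List α), E.length < k → a ≤ b → b < c →
    R (p ++ a :: c :: (E ++ b :: s)) (p ++ c :: a :: (E ++ b :: s))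

/-- Letters `a < c` commute if fewer than `k` letters earlier there is some `b ∈ (a, c]`. -/
def CommAfter (R : List α → List α → Prop) (k : ℕ) : Prop :=
  ∀ (a b c : α) (E p s : List α), E.length < k → a < b → b ≤ c →
    R (p ++ b :: (E ++ a :: c :: s)) (p ++ b :: (E ++ c :: a :: s))

/-- The relation `R` transported along the reversal of both the words and the order. -/
def dualRel (R : List α → List α → Prop) (u v : List αᵒᵈ) : Prop :=
  R (u.reverse.map OrderDual.ofDual) (v.reverse.map OrderDual.ofDual)

variable {R : List α → List α → Prop}

theorem HypoLike.dual (h : HypoLike R) : HypoLike (dualRel R) where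
  symm := h.symm
  trans := h.trans
  context p s H := by
    have := h.context (s.reverse.map OrderDual.ofDual) (p.reverse.map OrderDual.ofDual) H
    simpa [dualRel] using this
  swap_left h₁ h₂ := h.swap_right h₂ h₁
  swap_right h₁ h₂ := h.swap_left h₂ h₁
  swap_both h₁ h₂ h₃ := h.swap_both h₃ h₂ h₁
  swap_both' h₁ h₂ h₃ := h.swap_both' h₃ h₂ h₁

/-- If a letter `l < a` and a letter `h ≥ c` directly precede `b ∈ [a, c)`, then `a` and `c`
commute. -/
theorem HypoLike.comm_of_low_high (hR : HypoLike R) {k : ℕ} (hB : CommBefore R k)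
    (hA : CommAfter R k) {a b c l h : α} (hab : a ≤ b) (hbc : b < c) (hl : l < a) (hh : c ≤ h)
    (P : List α) (hP : P.length + 2 ≤ k) :
    R (a :: c :: (P ++ [l, h, b])) (c :: a :: (P ++ [l, h, b])) := by
  have hlb : l < b := hl.trans_le hab
  have hbh : b < h := hbc.trans_le hh
  have e₁ := hR.symm (hA b c h (P ++ [l]) [a] [] (by simp; omega) hbc hh)
  have e₂ := hB a b c (P ++ [l]) [] [h] (by simp; omega) hab hbc
  have e₃ := hA l a b P [c] [h] (by omega) hl hab
  have e₄ := hA l b h [] (c :: a :: P) [] (by simp; omega) hlb hbh.le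
  have e₅ := hA b c h (a :: P) [] [l] (by simp; omega) hbc hh
  have e₆ := hR.symm (hA l a b (P ++ [h]) [c] [] (by simp; omega) hl hab)
  have e₇ := hR.symm (hB l b h [] (c :: a :: P) [] (by simp; omega) hlb.le hbh)
  simp only [List.append_assoc, List.cons_append, List.nil_append] at *
  exact hR.trans e₁ <| hR.trans e₂ <| hR.trans e₃ <| hR.trans e₄ <| hR.trans e₅ <|
    hR.trans e₆ e₇

/-- A word `E` allows `a` and `c` to commute in front of `E b`. -/
def CommThrough (R : List α → List α → Prop) (a b c : α) (E : List α) : Prop :=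
  R (a :: c :: (E ++ [b])) (c :: a :: (E ++ [b]))

theorem HypoLike.commThrough_swap (hR : HypoLike R) {k : ℕ} (hB : CommBefore R k)
    {a b c l h : α} (hlb : l ≤ b) (hbh : b < h) (P Q : List α) (hQ : Q.length < k) :
    CommThrough R a b c (P ++ l :: h :: Q) ↔ CommThrough R a b c (P ++ h :: l :: Q) := by
  have e₁ := hB l b h Q (a :: c :: P) [] hQ hlb hbh
  have e₂ := hB l b h Q (c :: a :: P) [] hQ hlb hbh
  simp only [CommThrough, List.append_assoc, List.cons_append] at *
  exact ⟨fun H => hR.trans (hR.symm e₁) (hR.trans H e₂),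
    fun H => hR.trans e₁ (hR.trans H (hR.symm e₂))⟩

theorem HypoLike.commThrough_low_high (hR : HypoLike R) {k : ℕ} (hB : CommBefore R k)
    (hA : CommAfter R k) {a b c l h : α} (hab : a ≤ b) (hbc : b < c) (hl : l < a) (hh : c ≤ h)
    (P F : List α) (hk : (P ++ l :: (F ++ [h])).length ≤ k) :
    CommThrough R a b c (P ++ l :: (F ++ [h])) := by
  induction F generalizing P l with
  | nil => simpa [CommThrough] using
      hR.comm_of_low_high hB hA hab hbc hl hh P (by simpa using hk)
  | cons f F ih =>
    by_cases hf : f < a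
    · simpa using ih hf (P ++ [l]) (by simpa [Nat.add_assoc, Nat.add_comm] using hk)
    by_cases hf' : f < c
    · have := hB a f c (P ++ [l]) [] (F ++ [h, b]) (by simp at hk ⊢; omega) (not_lt.1 hf) hf'
      simpa [CommThrough] using this
    · refine (hR.commThrough_swap hB (hl.le.trans hab) (hbc.trans_le (not_lt.1 hf')) P (F ++ [h])
        (by simp at hk ⊢; omega)).2 ?_
      simpa using ih hl (P ++ [f]) (by simp at hk ⊢; omega)

theorem HypoLike.commThrough_high_low (hR : HypoLike R) {k : ℕ} (hB : CommBefore R k)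
    (hA : CommAfter R k) {a b c l h : α} (hab : a ≤ b) (hbc : b < c) (hl : l < a) (hh : c ≤ h)
    (P F : List α) (hk : (P ++ h :: (F ++ [l])).length ≤ k) :
    CommThrough R a b c (P ++ h :: (F ++ [l])) := by
  induction F generalizing P h with
  | nil =>
    refine (hR.commThrough_swap hB (hl.le.trans hab) (hbc.trans_le hh) P []
        (by simp at hk ⊢; omega)).1 ?_
    simpa [CommThrough] using hR.comm_of_low_high hB hA hab hbc hl hh P (by simpa using hk)
  | cons f F ih =>
    by_cases hf : c ≤ f
    · simpa using ih hf (P ++ [h]) (by simp at hk ⊢; omega)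
    by_cases hf' : a ≤ f
    · have := hB a f c (P ++ [h]) [] (F ++ [l, b]) (by simp at hk ⊢; omega) hf' (not_le.1 hf)
      simpa [CommThrough] using this
    · refine (hR.commThrough_swap hB ((not_le.1 hf').le.trans hab) (hbc.trans_le hh) P (F ++ [l])
        (by simp at hk ⊢; omega)).1 ?_
      simpa using ih hh (P ++ [f]) (by simp at hk ⊢; omega)

theorem HypoLike.commThrough_singleton (hR : HypoLike R) {a b c : α} (hab : a ≤ b) (hbc : b < c)
    (e : α) : CommThrough R a b c [e] := by
  have ctx : ∀ {u v : List α} (s : List α), R u v → R (u ++ s) (v ++ s) := fun s H =>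
    hR.context [] s H
  have ctx' : ∀ {u v : List α} (p : List α), R u v → R (p ++ u) (p ++ v) := fun p H => by
    simpa using hR.context p [] H
  change R [a, c, e, b] [c, a, e, b]
  by_cases he : e < a
  · exact hR.trans (hR.swap_both' he hab hbc) (hR.symm (ctx' [c] (hR.swap_right he hab)))
  by_cases he' : e < c
  · exact ctx [b] (hR.swap_left (not_lt.1 he) he')
  · exact hR.trans (ctx' [a] (hR.symm (hR.swap_right hbc (not_lt.1 he'))))
      (hR.symm (hR.swap_both hab hbc (not_lt.1 he')))

theorem HypoLike.commThrough (hR : HypoLike R) {k : ℕ} (hB : CommBefore R k)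
    (hA : CommAfter R k) {a b c : α} (hab : a ≤ b) (hbc : b < c)
    (E : List α) (hk : E.length ≤ k) : CommThrough R a b c E := by
  rcases E with _ | ⟨e, E⟩
  · exact hR.swap_left hab hbc
  rcases List.eq_nil_or_concat' E with rfl | ⟨F, g, rfl⟩
  · exact hR.commThrough_singleton hab hbc e
  have hF : F.length + 2 ≤ k := by simp at hk; omega
  -- it suffices to move `b` to the left of `g`
  have move : (∀ x y : α, R (x :: y :: e :: (F ++ [b, g])) (x :: y :: e :: (F ++ [g, b]))) →
      CommThrough R a b c (e :: (F ++ [g])) := fun H => by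
    have e₁ := hB a b c (e :: F) [] [g] (by simp; omega) hab hbc
    simp only [CommThrough, List.append_assoc, List.cons_append, List.nil_append] at e₁ ⊢
    exact hR.trans (hR.symm (H a c)) (hR.trans e₁ (H c a))
  have comm := hB a b c (F ++ [g]) [e] [] (by simp; omega) hab hbc
  by_cases hg : a ≤ g ∧ g < c
  · have := hB a g c (e :: F) [] [b] (by simp; omega) hg.1 hg.2
    simpa [CommThrough] using this
  by_cases he : e < a
  · by_cases hg' : g < a
    · by_cases hge : g < e
      · exact move fun x y => by
          simpa using hR.symm (hA g e b F [x, y] [] (by omega) hge (he.le.trans hab))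
      · have hge := not_lt.1 hge
        have e₁ := hB e g a F [c] [b] (by omega) hge hg'
        have e₂ := hB e a c [] [] (F ++ [g, b]) (by simp; omega) he.le (hab.trans_lt hbc)
        have e₃ := hB e g a (c :: F) [] [b] (by simp; omega) hge hg'
        have e₄ := hB e b c (F ++ [g]) [a] [] (by simp; omega) (he.le.trans hab) hbc
        simp only [CommThrough, List.append_assoc, List.cons_append, List.nil_append] at *
        exact hR.trans (hR.symm e₄) <| hR.trans (hR.symm e₃) <| hR.trans comm <|
          hR.trans e₂ e₁
    · exact hR.commThrough_low_high hB hA hab hbc he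
        (not_lt.1 fun h => hg ⟨not_lt.1 hg', h⟩) [] F hk
  by_cases he' : e < c
  · have := hB a e c [] [] (F ++ [g, b]) (by simp; omega) (not_lt.1 he) he'
    simpa [CommThrough] using this
  have he' := not_lt.1 he'
  by_cases hg' : g < a
  · exact hR.commThrough_high_low hB hA hab hbc hg' he' [] F hk
  have hg' : c ≤ g := not_lt.1 fun h => hg ⟨not_lt.1 hg', h⟩
  by_cases hge : g < e
  · have e₁ := hB c g e F [a] [b] (by omega) hg' hge
    have e₂ := hB a c e [] [] (F ++ [g, b]) (by simp; omega) (hab.trans hbc.le)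
      (hg'.trans_lt hge)
    have e₃ := hB c g e (a :: F) [] [b] (by simp; omega) hg' hge
    have e₄ := hB a b e (F ++ [g]) [c] [] (by simp; omega) hab (hbc.trans_le he')
    simp only [CommThrough, List.append_assoc, List.cons_append, List.nil_append] at *
    exact hR.trans e₁ <| hR.trans e₂ <| hR.trans comm <|
      hR.trans (hR.symm e₃) (hR.symm e₄)
  · exact move fun x y => by
      simpa using hA b e g F [x, y] [] (by omega) (hbc.trans_le he') (not_lt.1 hge)

theorem HypoLike.commBefore_succ (hR : HypoLike R) {k : ℕ} (hB : CommBefore R k)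
    (hA : CommAfter R k) : CommBefore R (k + 1) := by
  intro a b c E p s hE hab hbc
  simpa using hR.context p s (hR.commThrough hB hA hab hbc E (Nat.lt_succ_iff.1 hE))

theorem commBefore_dualRel {k : ℕ} : CommBefore (dualRel R) k ↔ CommAfter R k := by
  constructor
  · intro H a b c E p s hE hab hbc
    have := H (OrderDual.toDual c) (OrderDual.toDual b) (OrderDual.toDual a)
      (E.reverse.map OrderDual.toDual) (s.reverse.map OrderDual.toDual)
      (p.reverse.map OrderDual.toDual) (by simpa using hE) hbc hab
    simpa [dualRel] using this
  · intro H a b c E p s hE hab hbc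
    have := H (OrderDual.ofDual c) (OrderDual.ofDual b) (OrderDual.ofDual a)
      (E.reverse.map OrderDual.ofDual) (s.reverse.map OrderDual.ofDual)
      (p.reverse.map OrderDual.ofDual) (by simpa using hE) hbc hab
    simpa [dualRel] using this

theorem commAfter_dualRel {k : ℕ} : CommAfter (dualRel R) k ↔ CommBefore R k := by
  constructor
  · intro H a b c E p s hE hab hbc
    have := H (OrderDual.toDual c) (OrderDual.toDual b) (OrderDual.toDual a)
      (E.reverse.map OrderDual.toDual) (s.reverse.map OrderDual.toDual)
      (p.reverse.map OrderDual.toDual) (by simpa using hE) hbc hab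
    simpa [dualRel] using this
  · intro H a b c E p s hE hab hbc
    have := H (OrderDual.ofDual c) (OrderDual.ofDual b) (OrderDual.ofDual a)
      (E.reverse.map OrderDual.ofDual) (s.reverse.map OrderDual.ofDual)
      (p.reverse.map OrderDual.ofDual) (by simpa using hE) hbc hab
    simpa [dualRel] using this

theorem HypoLike.commBefore_and_commAfter (hR : HypoLike R) (k : ℕ) :
    CommBefore R k ∧ CommAfter R k := by
  induction k with
  | zero =>
    exact ⟨fun _ _ _ _ _ _ h => absurd h (Nat.not_lt_zero _),
      fun _ _ _ _ _ _ h => absurd h (Nat.not_lt_zero _)⟩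
  | succ k ih =>
    exact ⟨hR.commBefore_succ ih.1 ih.2, commBefore_dualRel.1 <|
      hR.dual.commBefore_succ (commBefore_dualRel.2 ih.2) (commAfter_dualRel.2 ih.1)⟩

theorem HypoLike.swap_of_lt (hR : HypoLike R) {a c : α} (hac : a < c) {p s : List α}
    (h : c ∈ p ∨ a ∈ s) : R (p ++ a :: c :: s) (p ++ c :: a :: s) := by
  rcases h with h | h
  · obtain ⟨q, E, rfl⟩ := List.append_of_mem h
    simpa using (hR.commBefore_and_commAfter (E.length + 1)).2 a c c E q s (by simp) hac le_rfl
  · obtain ⟨E, q, rfl⟩ := List.append_of_mem h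
    exact (hR.commBefore_and_commAfter (E.length + 1)).1 a a c E p q (by simp) le_rfl hac

theorem HypoLike.swap (hR : HypoLike R) (hrefl : ∀ u, R u u) {p s : List α} {x y : α}
    (h : SwapOk p s x y) : R (p ++ x :: y :: s) (p ++ y :: x :: s) := by
  rcases lt_trichotomy x y with hxy | rfl | hxy
  · exact hR.swap_of_lt hxy h.1
  · exact hrefl _
  · exact hR.symm (hR.swap_of_lt hxy h.2)

end HypoLike

section Hypoplactic

open scoped List

theorem hypoCon_hypoLike :
    HypoLike fun u v : List Alph => hypoCon (ofList u) (ofList v) where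
  symm := hypoCon.symm
  trans := hypoCon.trans
  context p s H := by
    simpa only [ofList_append] using
      hypoCon.mul (hypoCon.refl (ofList p)) (hypoCon.mul H (hypoCon.refl (ofList s)))
  swap_left {a b c} h₁ h₂ := ConGen.Rel.of _ _ (Or.inl ⟨a, b, c, h₁, h₂, rfl, rfl⟩)
  swap_right {a b c} h₁ h₂ := ConGen.Rel.of _ _ (Or.inr (Or.inl ⟨a, b, c, h₁, h₂, rfl, rfl⟩))
  swap_both {a b c d} h₁ h₂ h₃ :=
    ConGen.Rel.of _ _ (Or.inr (Or.inr (Or.inl ⟨a, b, c, d, h₁, h₂, h₃, rfl, rfl⟩)))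
  swap_both' {a b c d} h₁ h₂ h₃ :=
    ConGen.Rel.of _ _ (Or.inr (Or.inr (Or.inr ⟨a, b, c, d, h₁, h₂, h₃, rfl, rfl⟩)))

/-- The class of a word in the hypoplactic monoid. -/
def hypoClass (u : List Alph) : Hypo := hypoCon.mk' (ofList u)

theorem hypoClass_append (u v : List Alph) :
    hypoClass (u ++ v) = hypoClass u * hypoClass v := rfl

theorem hypoClass_surjective : Function.Surjective hypoClass := fun m => by
  obtain ⟨u, rfl⟩ := Con.mk'_surjective m
  exact ⟨u.toList, rfl⟩

theorem swapInvariant_hypoClass : SwapInvariant hypoClass := fun _ _ _ _ h =>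
  hypoCon.eq.2 (hypoCon_hypoLike.swap (fun _ => hypoCon.refl _) h)

/-- Words with equally many letters `1` and `2` in which `2` precedes `1` simultaneously. -/
def inversionCon : Con (FreeMonoid Alph) where
  r u v := u.toList.count 1 = v.toList.count 1 ∧ u.toList.count 2 = v.toList.count 2 ∧
    ([2, 1] <+ u.toList ↔ [2, 1] <+ v.toList)
  iseqv := ⟨fun _ => ⟨rfl, rfl, Iff.rfl⟩, fun h => ⟨h.1.symm, h.2.1.symm, h.2.2.symm⟩,
    fun h h' => ⟨h.1.trans h'.1, h.2.1.trans h'.2.1, h.2.2.trans h'.2.2⟩⟩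
  mul' {u v u' v'} h h' := by
    have mem_iff : ∀ {i : Alph} {u v : FreeMonoid Alph}, u.toList.count i = v.toList.count i →
        (i ∈ u.toList ↔ i ∈ v.toList) := fun H => by
      rw [← List.count_pos_iff, ← List.count_pos_iff, H]
    simp only [toList_mul, List.count_append, pair_sublist_append]
    rw [h.1, h.2.1, h.2.2, h'.1, h'.2.1, h'.2.2, mem_iff h.2.1, mem_iff h'.1]
    exact ⟨rfl, rfl, Iff.rfl⟩

theorem hypoCon_le_inversionCon : hypoCon ≤ inversionCon := by
  refine Con.conGen_le.2 fun u v h => ?_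
  rcases h with ⟨a, b, c, h₁, h₂, rfl, rfl⟩ | ⟨a, b, c, h₁, h₂, rfl, rfl⟩ |
    ⟨a, b, c, d, h₁, h₂, h₃, rfl, rfl⟩ | ⟨a, b, c, d, h₁, h₂, h₃, rfl, rfl⟩ <;>
  refine ⟨?_, ?_, ?_⟩
  all_goals
    have ha := a.pos
    simp only [toList_mul, toList_of, List.cons_append, List.nil_append,
      List.count_cons, List.count_nil, pair_sublist_cons, List.mem_cons, List.not_mem_nil,
      List.sublist_nil, reduceCtorEq, ← PNat.coe_le_coe, ← PNat.coe_lt_coe, ← PNat.coe_inj,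
      PNat.val_ofNat, beq_iff_eq] at *
    first | omega | grind

theorem inversionCon_of_satisfies {X : Type*} {u v : FreeMonoid X} (h : MSatisfies Hypo u v)
    (σ : FreeMonoid X →* FreeMonoid Alph) : inversionCon (σ u) (σ v) :=
  hypoCon_le_inversionCon (hypoCon.eq.1 (h (hypoCon.mk'.comp σ)))

/-- The substitution `x ↦ 2`, `y ↦ 1` erasing all the other variables. -/
def pairSubst {X : Type*} [DecidableEq X] (x y : X) : FreeMonoid X →* FreeMonoid Alph :=
  FreeMonoid.lift fun z => if z = x then of 2 else if z = y then of 1 else 1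

theorem toList_pairSubst_cons {X : Type*} [DecidableEq X] (x y z : X) (l : List X) :
    (pairSubst x y (ofList (z :: l))).toList =
      (if z = x then [2] else if z = y then [1] else []) ++
        (pairSubst x y (ofList l)).toList := by
  rw [ofList_cons, map_mul, toList_mul, pairSubst, lift_eval_of]
  split_ifs <;> rfl

theorem count_pairSubst {X : Type*} [DecidableEq X] (x y : X) (l : List X) :
    (pairSubst x y (ofList l)).toList.count 2 = l.count x := by
  induction l with
  | nil => rfl
  | cons z l ih =>
    rw [toList_pairSubst_cons, List.count_append, ih, List.count_cons]
    split_ifs <;> simp_all [Nat.add_comm]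

theorem one_mem_pairSubst {X : Type*} [DecidableEq X] {x y : X} (hxy : x ≠ y) (l : List X) :
    1 ∈ (pairSubst x y (ofList l)).toList ↔ y ∈ l := by
  induction l with
  | nil => simp
  | cons z l ih =>
    rw [toList_pairSubst_cons, List.mem_append, ih, List.mem_cons]
    split_ifs with h₁ h₂
    · simp [h₁, hxy.symm]
    · simp [h₂]
    · simp [Ne.symm h₂]

theorem sublist_pairSubst {X : Type*} [DecidableEq X] {x y : X} (hxy : x ≠ y) (l : List X) :
    [2, 1] <+ (pairSubst x y (ofList l)).toList ↔ [x, y] <+ l := by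
  induction l with
  | nil => simp
  | cons z l ih =>
    rw [toList_pairSubst_cons, pair_sublist_append, ih, one_mem_pairSubst hxy, pair_sublist_cons]
    split_ifs with h₁ h₂
    · simp [h₁]
    · simp [h₂, hxy]
    · simp [Ne.symm h₁]

theorem pairEquiv_of_satisfies {X : Type*} {u v : FreeMonoid X} (h : MSatisfies Hypo u v) :
    PairEquiv u.toList v.toList := by
  classical
  refine ⟨List.perm_iff_count.2 fun x => ?_, fun x y hxy => ?_⟩
  · have := (inversionCon_of_satisfies h (pairSubst x x)).2.1
    rwa [← ofList_toList u, ← ofList_toList v, count_pairSubst, count_pairSubst] at this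
  · have := (inversionCon_of_satisfies h (pairSubst x y)).2.2
    rwa [← ofList_toList u, ← ofList_toList v, sublist_pairSubst hxy,
      sublist_pairSubst hxy] at this

end Hypoplactic

section Basis

/-- The identity `xyzxty ≈ yxzxty`. -/
def identityL : FreeMonoid (Fin 4) × FreeMonoid (Fin 4) :=
  (ofList [0, 1, 2, 0, 3, 1], ofList [1, 0, 2, 0, 3, 1])

/-- The identity `xzxytx ≈ xzyxtx`. -/
def identityM : FreeMonoid (Fin 4) × FreeMonoid (Fin 4) :=
  (ofList [0, 2, 0, 1, 3, 0], ofList [0, 2, 1, 0, 3, 0])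

/-- The identity `xzytxy ≈ xzytyx`. -/
def identityR : FreeMonoid (Fin 4) × FreeMonoid (Fin 4) :=
  (ofList [0, 2, 1, 3, 0, 1], ofList [0, 2, 1, 3, 1, 0])

variable {M : Type*} [Monoid M]

theorem satisfies_identityL : MSatisfies M identityL.1 identityL.2 ↔
    ∀ x y z t : M, x * (y * (z * (x * (t * y)))) = y * (x * (z * (x * (t * y)))) := by
  constructor
  · intro h x y z t
    simpa [identityL, ofList_cons] using h (FreeMonoid.lift ![x, y, z, t])
  · intro h ψ
    simpa [identityL, ofList_cons] using h (ψ (of 0)) (ψ (of 1)) (ψ (of 2)) (ψ (of 3))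

theorem satisfies_identityM : MSatisfies M identityM.1 identityM.2 ↔
    ∀ x y z t : M, x * (z * (x * (y * (t * x)))) = x * (z * (y * (x * (t * x)))) := by
  constructor
  · intro h x y z t
    simpa [identityM, ofList_cons] using h (FreeMonoid.lift ![x, y, z, t])
  · intro h ψ
    simpa [identityM, ofList_cons] using h (ψ (of 0)) (ψ (of 1)) (ψ (of 2)) (ψ (of 3))

theorem satisfies_identityR : MSatisfies M identityR.1 identityR.2 ↔
    ∀ x y z t : M, x * (z * (y * (t * (x * y)))) = x * (z * (y * (t * (y * x)))) := by
  constructor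
  · intro h x y z t
    simpa [identityR, ofList_cons] using h (FreeMonoid.lift ![x, y, z, t])
  · intro h ψ
    simpa [identityR, ofList_cons] using h (ψ (of 0)) (ψ (of 1)) (ψ (of 2)) (ψ (of 3))

theorem hypo_satisfies_identityL : MSatisfies Hypo identityL.1 identityL.2 := by
  refine satisfies_identityL.2 fun x y z t => ?_
  obtain ⟨x, rfl⟩ := hypoClass_surjective x
  obtain ⟨y, rfl⟩ := hypoClass_surjective y
  obtain ⟨z, rfl⟩ := hypoClass_surjective z
  obtain ⟨t, rfl⟩ := hypoClass_surjective t
  exact swapInvariant_hypoClass.move_word [] (z ++ (x ++ (t ++ y))) x y fun i hi j hj =>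
    ⟨Or.inr (by simp [hi]), Or.inr (by simp [hj])⟩

theorem hypo_satisfies_identityM : MSatisfies Hypo identityM.1 identityM.2 := by
  refine satisfies_identityM.2 fun x y z t => ?_
  obtain ⟨x, rfl⟩ := hypoClass_surjective x
  obtain ⟨y, rfl⟩ := hypoClass_surjective y
  obtain ⟨z, rfl⟩ := hypoClass_surjective z
  obtain ⟨t, rfl⟩ := hypoClass_surjective t
  have := swapInvariant_hypoClass.move_word (x ++ z) (t ++ x) x y fun i hi j hj =>
    ⟨Or.inr (by simp [hi]), Or.inl (by simp [hi])⟩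
  simpa only [hypoClass_append, mul_assoc] using this

theorem hypo_satisfies_identityR : MSatisfies Hypo identityR.1 identityR.2 := by
  refine satisfies_identityR.2 fun x y z t => ?_
  obtain ⟨x, rfl⟩ := hypoClass_surjective x
  obtain ⟨y, rfl⟩ := hypoClass_surjective y
  obtain ⟨z, rfl⟩ := hypoClass_surjective z
  obtain ⟨t, rfl⟩ := hypoClass_surjective t
  have := swapInvariant_hypoClass.move_word (x ++ (z ++ (y ++ t))) [] x y fun i hi j hj =>
    ⟨Or.inl (by simp [hj]), Or.inl (by simp [hi])⟩
  simpa only [hypoClass_append, mul_assoc, List.append_nil] using this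

theorem exists_split_of_mem_of_mem {X : Type*} {x y : X} {l : List X} (hx : x ∈ l) (hy : y ∈ l)
    (hxy : x ≠ y) :
    ∃ l₁ l₂ l₃, l = l₁ ++ x :: (l₂ ++ y :: l₃) ∨ l = l₁ ++ y :: (l₂ ++ x :: l₃) := by
  obtain ⟨p, s, rfl⟩ := List.append_of_mem hx
  rcases List.mem_append.1 hy with hy | hy
  · obtain ⟨q, r, rfl⟩ := List.append_of_mem hy
    exact ⟨q, r, s, Or.inr (by simp)⟩
  · obtain ⟨q, r, rfl⟩ := List.append_of_mem (List.mem_of_ne_of_mem hxy.symm hy)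
    exact ⟨p, q, r, Or.inl rfl⟩

theorem swapInvariant_of_satisfies (hL : MSatisfies M identityL.1 identityL.2)
    (hM : MSatisfies M identityM.1 identityM.2) (hR : MSatisfies M identityR.1 identityR.2)
    {X : Type*} (ψ : FreeMonoid X →* M) : SwapInvariant fun l => ψ (ofList l) := by
  rw [satisfies_identityL] at hL
  rw [satisfies_identityM] at hM
  rw [satisfies_identityR] at hR
  have middle : ∀ (p s : List X) (x y : X), x ∈ p → x ∈ s →
      ψ (ofList (p ++ x :: y :: s)) = ψ (ofList (p ++ y :: x :: s)) := by
    intro p s x y hp hs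
    obtain ⟨p, q, rfl⟩ := List.append_of_mem hp
    obtain ⟨r, s, rfl⟩ := List.append_of_mem hs
    simpa [ofList_append, ofList_cons, mul_assoc] using congrArg
      (fun m => ψ (ofList p) * m * ψ (ofList s))
      (hM (ψ (of x)) (ψ (of y)) (ψ (ofList q)) (ψ (ofList r)))
  have left : ∀ (p q r s : List X) (x y : X),
      ψ (ofList (p ++ x :: y :: (q ++ x :: (r ++ y :: s)))) =
        ψ (ofList (p ++ y :: x :: (q ++ x :: (r ++ y :: s)))) := by
    intro p q r s x y
    simpa [ofList_append, ofList_cons, mul_assoc] using congrArg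
      (fun m => ψ (ofList p) * m * ψ (ofList s))
      (hL (ψ (of x)) (ψ (of y)) (ψ (ofList q)) (ψ (ofList r)))
  have right : ∀ (p q r s : List X) (x y : X),
      ψ (ofList ((p ++ x :: (q ++ y :: r)) ++ x :: y :: s)) =
        ψ (ofList ((p ++ x :: (q ++ y :: r)) ++ y :: x :: s)) := by
    intro p q r s x y
    simpa [ofList_append, ofList_cons, mul_assoc] using congrArg
      (fun m => ψ (ofList p) * m * ψ (ofList s))
      (hR (ψ (of x)) (ψ (of y)) (ψ (ofList q)) (ψ (ofList r)))
  rintro p s x y ⟨h₁, h₂⟩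
  rcases eq_or_ne x y with rfl | hxy
  · rfl
  rcases h₁ with hy | hx <;> rcases h₂ with hx' | hy'
  · obtain ⟨l₁, l₂, l₃, rfl | rfl⟩ := exists_split_of_mem_of_mem hx' hy hxy
    · exact right l₁ l₂ l₃ s x y
    · exact (right l₁ l₂ l₃ s y x).symm
  · exact (middle p s y x hy hy').symm
  · exact middle p s x y hx' hx
  · obtain ⟨l₁, l₂, l₃, rfl | rfl⟩ := exists_split_of_mem_of_mem hx hy' hxy
    · exact left p l₁ l₂ l₃ x y
    · exact (left p l₁ l₂ l₃ y x).symm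

end Basis

section LowerBound

open scoped List

/-- The syntactic congruence of the word `w`. -/
def syntacticCon {X : Type*} (w : FreeMonoid X) : Con (FreeMonoid X) where
  r u v := ∀ p s, p * u * s = w ↔ p * v * s = w
  iseqv := ⟨fun _ _ _ => Iff.rfl, fun h p s => (h p s).symm,
    fun h h' p s => (h p s).trans (h' p s)⟩
  mul' {u₁ v₁ u₂ v₂} h₁ h₂ p s := by
    rw [← mul_assoc, h₂ (p * u₁) s, ← mul_assoc p v₁ v₂, mul_assoc (p * u₁) v₂ s, h₁ p (v₂ * s),
      mul_assoc (p * v₁) v₂ s]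

/-- The left-hand side of `identityL` as a list. -/
def wordL : List (Fin 4) := [0, 1, 2, 0, 3, 1]

theorem eq_nil_of_append_eq_wordL {A B : List (Fin 4)} (h : A ++ 0 :: 1 :: B = wordL) :
    A = [] ∧ B = [2, 0, 3, 1] := by
  rcases A with _ | ⟨_, _ | ⟨_, _ | ⟨_, _ | ⟨_, _ | ⟨_, _ | ⟨_, A⟩⟩⟩⟩⟩⟩ <;> simp_all [wordL]

theorem eq_of_append_eq_of_one_mem {U s : List (Fin 4)} (h : U ++ s = [2, 0, 3, 1])
    (hU : 1 ∈ U) : U = [2, 0, 3, 1] := by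
  rcases U with _ | ⟨_, _ | ⟨_, _ | ⟨_, _ | ⟨_, A⟩⟩⟩⟩ <;> simp_all

theorem pair_sublist_of_mem {X : Type*} {x y : X} {l : List X} (hx : x ∈ l) (hy : y ∈ l)
    (hxy : x ≠ y) : [x, y] <+ l ∨ [y, x] <+ l := by
  obtain ⟨l₁, l₂, l₃, rfl | rfl⟩ := exists_split_of_mem_of_mem hx hy hxy
  · left; simp
  · right; simp

theorem pair_sublist_flatMap {X Y : Type*} {g : X → List Y} {x y : X} {e f : Y} {l : List X}
    (h : [x, y] <+ l) (he : e ∈ g x) (hf : f ∈ g y) : [e, f] <+ l.flatMap g := by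
  have : [e] ++ [f] <+ g x ++ g y :=
    (List.singleton_sublist.2 he).append (List.singleton_sublist.2 hf)
  exact this.trans (by simpa using h.flatMap g)

theorem eq_singleton_of_factor {e : Fin 4} {l : List (Fin 4)} (hl : l <:+: wordL) (hne : l ≠ [])
    (h : ∀ i ∈ l, i = e) : l = [e] := by
  rcases l with _ | ⟨i, _ | ⟨j, l⟩⟩
  · exact absurd rfl hne
  · simpa using h i
  · obtain rfl := h i (by simp)
    obtain rfl := h j (by simp)
    have : [j, j] <:+: wordL := List.IsInfix.trans ⟨[], l, by simp⟩ hl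
    have noSquare : ∀ i : Fin 4, ¬ [i, i] <:+: wordL := by decide
    exact absurd this (noSquare j)

theorem flatMap_swap_eq_wordL {g : Fin 3 → List (Fin 4)} {P S : List (Fin 3)} {x y : Fin 3}
    (hok : SwapOk P S x y) {p s : List (Fin 4)}
    (h : p ++ (P ++ x :: y :: S).flatMap g ++ s = wordL) :
    p ++ (P ++ y :: x :: S).flatMap g ++ s = wordL := by
  rcases eq_or_ne x y with rfl | hxy
  · exact h
  rcases eq_or_ne (g x) [] with hgx | hgx
  · simpa [hgx] using h
  rcases eq_or_ne (g y) [] with hgy | hgy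
  · simpa [hgy] using h
  exfalso
  have hw : p ++ (P.flatMap g ++ (g x ++ (g y ++ (S.flatMap g ++ s)))) = wordL := by
    simpa using h
  have sub : ∀ {k l m : List (Fin 4)}, k <+ P.flatMap g → l <+ g x ++ g y → m <+ S.flatMap g →
      k ++ (l ++ m) <+ wordL := fun hk hl hm => by
    rw [← hw]
    refine List.Sublist.trans ?_ (List.sublist_append_right _ _)
    rw [← List.append_assoc (g x)]
    exact hk.append (hl.append (hm.trans (List.sublist_append_left _ _)))
  have single : ∀ {i : Fin 3} {e : Fin 4} {l : List (Fin 3)}, i ∈ l → e ∈ g i →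
      [e] <+ l.flatMap g := fun hi he =>
    List.singleton_sublist.2 (List.mem_flatMap.2 ⟨_, hi, he⟩)
  have both : ∀ {e f : Fin 4}, e ∈ g x → f ∈ g y → [e, f] <+ g x ++ g y := fun he hf =>
    (List.singleton_sublist.2 he).append (List.singleton_sublist.2 hf)
  -- the admissible exchange uses two occurrences of `x` and `y` on the same side
  have side : (x ∈ P ∧ y ∈ P) ∨ (x ∈ S ∧ y ∈ S) := by
    have noCube : ∀ e : Fin 4, ¬ [e, e, e] <+ wordL := by decide
    obtain ⟨e, he⟩ := List.exists_mem_of_ne_nil _ hgx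
    obtain ⟨f, hf⟩ := List.exists_mem_of_ne_nil _ hgy
    rcases hok with ⟨hy | hx, hx' | hy'⟩
    · exact Or.inl ⟨hx', hy⟩
    · exact absurd (sub (single hy hf) (List.singleton_sublist.2 (List.mem_append_right _ hf))
        (single hy' hf)) (noCube f)
    · exact absurd (sub (single hx' he) (List.singleton_sublist.2 (List.mem_append_left _ he))
        (single hx he)) (noCube e)
    · exact Or.inr ⟨hx, hy'⟩
  have letters : ∀ e ∈ g x, ∀ f ∈ g y, e = 0 ∧ f = 1 := by
    intro e he f hf
    have abab : ∀ e f : Fin 4, [e, f, e, f] <+ wordL → e = 0 ∧ f = 1 := by decide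
    have abba : ∀ e f : Fin 4, ¬ [e, f, f, e] <+ wordL := by decide
    rcases side with ⟨hx, hy⟩ | ⟨hx, hy⟩
    · rcases pair_sublist_of_mem hx hy hxy with H | H
      · exact abab e f (sub (pair_sublist_flatMap H he hf) (both he hf) (List.nil_sublist _))
      · exact absurd (sub (pair_sublist_flatMap H hf he) (both he hf) (List.nil_sublist _))
          (abba f e)
    · rcases pair_sublist_of_mem hx hy hxy with H | H
      · exact abab e f (sub (List.nil_sublist _) (both he hf) (pair_sublist_flatMap H he hf))
      · exact absurd (sub (List.nil_sublist _) (both he hf) (pair_sublist_flatMap H hf he))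
          (abba e f)
  have hgx' : g x = [0] := eq_singleton_of_factor
    ⟨p ++ P.flatMap g, g y ++ (S.flatMap g ++ s), by simpa using hw⟩ hgx fun e he =>
      (letters e he _ (List.head_mem hgy)).1
  have hgy' : g y = [1] := eq_singleton_of_factor
    ⟨p ++ P.flatMap g ++ g x, S.flatMap g ++ s, by simpa using hw⟩ hgy fun f hf =>
      (letters _ (List.head_mem hgx) f hf).2
  rw [hgx', hgy', ← List.append_assoc] at hw
  obtain ⟨hA, hB⟩ := eq_nil_of_append_eq_wordL hw
  rcases side with ⟨hx, -⟩ | ⟨hx, hy⟩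
  · have := single (e := 0) hx (by simp [hgx'])
    simp [(List.append_eq_nil_iff.1 hA).2] at this
  have hS := eq_of_append_eq_of_one_mem (U := S.flatMap g) hB
    (List.singleton_sublist.1 (single (e := 1) hy (by simp [hgy'])))
  -- the letters `2` and `3` come from the same variable, which is neither `x` nor `y`
  obtain ⟨c, hc, hc2⟩ := List.mem_flatMap.1 (show 2 ∈ S.flatMap g by simp [hS])
  obtain ⟨d, hd, hd3⟩ := List.mem_flatMap.1 (show 3 ∈ S.flatMap g by simp [hS])
  have hcx : c ≠ x := by rintro rfl; simp [hgx'] at hc2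
  have hcy : c ≠ y := by rintro rfl; simp [hgy'] at hc2
  have hdx : d ≠ x := by rintro rfl; simp [hgx'] at hd3
  have hdy : d ≠ y := by rintro rfl; simp [hgy'] at hd3
  obtain rfl : c = d := by omega
  rcases pair_sublist_of_mem hx hc hcx.symm with H | H
  · have := pair_sublist_flatMap H (e := 0) (by simp [hgx']) hc2
    rw [hS] at this
    revert this
    decide
  · have := pair_sublist_flatMap H hd3 (f := 0) (by simp [hgx'])
    rw [hS] at this
    revert this
    decide

theorem toList_hom_eq_flatMap {X Y : Type*} (σ : FreeMonoid X →* FreeMonoid Y) (l : List X) :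
    (σ (ofList l)).toList = l.flatMap fun x => (σ (of x)).toList := by
  induction l with
  | nil => simp
  | cons x l ih => rw [ofList_cons, map_mul, toList_mul, ih, List.flatMap_cons]

theorem syntacticCon_swap (σ : FreeMonoid (Fin 3) →* FreeMonoid (Fin 4)) {P S : List (Fin 3)}
    {x y : Fin 3} (hok : SwapOk P S x y) :
    syntacticCon (ofList wordL) (σ (ofList (P ++ x :: y :: S)))
      (σ (ofList (P ++ y :: x :: S))) := by
  have key : ∀ {u v : List (Fin 3)} {p s : FreeMonoid (Fin 4)},
      (p.toList ++ (u.flatMap fun x => (σ (of x)).toList) ++ s.toList = wordL →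
        p.toList ++ (v.flatMap fun x => (σ (of x)).toList) ++ s.toList = wordL) →
      p * σ (ofList u) * s = ofList wordL → p * σ (ofList v) * s = ofList wordL := by
    intro u v p s H
    simpa only [← toList.injective.eq_iff, toList_mul, toList_hom_eq_flatMap,
      toList_ofList] using H
  exact fun p s => ⟨key (flatMap_swap_eq_wordL hok), key (flatMap_swap_eq_wordL ⟨hok.2, hok.1⟩)⟩

/-- The syntactic monoid of `xyzxty` satisfies every identity of `hypo` in three variables. -/
theorem syntacticMonoid_satisfies {u v : FreeMonoid (Fin 3)} (h : MSatisfies Hypo u v) :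
    MSatisfies (syntacticCon (ofList wordL)).Quotient u v := by
  intro ψ
  choose g hg using fun i => Con.mk'_surjective (c := syntacticCon (ofList wordL)) (ψ (of i))
  obtain rfl : (syntacticCon (ofList wordL)).mk'.comp (FreeMonoid.lift g) = ψ :=
    FreeMonoid.hom_eq fun i => by simpa using hg i
  have hinv : SwapInvariant fun l : List (Fin 3) =>
      (syntacticCon (ofList wordL)).mk' (FreeMonoid.lift g (ofList l)) :=
    fun _ _ _ _ hok => (Con.eq _).2 (syntacticCon_swap _ hok)
  exact hinv.eq_of_pairEquiv (pairEquiv_of_satisfies h)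

theorem syntacticMonoid_not_satisfies_identityL :
    ¬ MSatisfies (syntacticCon (ofList wordL)).Quotient identityL.1 identityL.2 := by
  intro h
  have := ((Con.eq _).1 (h (syntacticCon (ofList wordL)).mk') 1 1).1 rfl
  exact absurd (congrArg toList this) (by decide)

end LowerBound

/-- There is no set `Σ` of identities in at most `3` distinct variables (formalized
as identities over the alphabet `Fin 3`) that is an equational basis for the variety
generated by `hypo`; but there is such a basis consisting of identities in at most `4`
variables (i.e. over `Fin 4`). Hence the axiomatic rank of the variety generated by
`hypo` is `4`. -/
theorem hypo_axiomatic_rank_four :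
    (¬ ∃ S : Set (FreeMonoid (Fin 3) × FreeMonoid (Fin 3)),
        ∀ (X : Type) (u v : FreeMonoid X),
          MSatisfies Hypo u v ↔
            ∀ (M : Type) [Monoid M],
              (∀ p ∈ S, MSatisfies M p.1 p.2) → MSatisfies M u v) ∧
    (∃ S : Set (FreeMonoid (Fin 4) × FreeMonoid (Fin 4)),
        ∀ (X : Type) (u v : FreeMonoid X),
          MSatisfies Hypo u v ↔
            ∀ (M : Type) [Monoid M],
              (∀ p ∈ S, MSatisfies M p.1 p.2) → MSatisfies M u v) := by
  constructor
  · rintro ⟨S, hS⟩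
    refine syntacticMonoid_not_satisfies_identityL
      ((hS (Fin 4) identityL.1 identityL.2).1 hypo_satisfies_identityL _ fun p hp => ?_)
    exact syntacticMonoid_satisfies ((hS (Fin 3) p.1 p.2).2 fun M _ hM => hM p hp)
  · refine ⟨{identityL, identityM, identityR}, fun X u v => ⟨fun h M _ hM ψ => ?_, fun h => ?_⟩⟩
    · exact (swapInvariant_of_satisfies (hM _ (by simp)) (hM _ (by simp)) (hM _ (by simp))
        ψ).eq_of_pairEquiv (pairEquiv_of_satisfies h)
    · refine h Hypo fun p hp => ?_
      rcases hp with rfl | rfl | rfl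
      · exact hypo_satisfies_identityL
      · exact hypo_satisfies_identityM
      · exact hypo_satisfies_identityR
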